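/- Normal-form reduction: if there exist A, B, C, D : Fin 2 → Matrix (Fin 2) (Fin 2) ℂ satisfying trace(A i * B j * C k * D l) = δ_{i,k} · δ_{j,l} for all i, j, k, l ∈ Fin 2, then there exist such families additionally satisfying A 0 = 1, B 0 = 1 and D 0 = 1 (the 2×2 identity matrix). -/

import Mathlib

open Matrix

/-- A singular `2 × 2` matrix over a field is an outer product of two vectors. -/
theorem Matrix.exists_eq_vecMulVec_of_det_eq_zero {K : Type*} [Field K]
    (M : Matrix (Fin 2) (Fin 2) K) (hM : M.det = 0) :
    ∃ v w : Fin 2 → K, M = vecMulVec v w := by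
  rw [det_fin_two] at hM
  by_cases ha : M 0 0 = 0
  · by_cases hb : M 0 1 = 0
    · refine ⟨![0, 1], ![M 1 0, M 1 1], ?_⟩
      ext i j
      fin_cases i <;> fin_cases j <;> simp [vecMulVec_apply, ha, hb]
    · have hc : M 1 0 = 0 := by simpa [ha, hb] using hM
      refine ⟨![1, M 1 1 / M 0 1], ![0, M 0 1], ?_⟩
      ext i j
      fin_cases i <;> fin_cases j <;> simp [vecMulVec_apply, ha, hb, hc]
  · refine ⟨![1, M 1 0 / M 0 0], ![M 0 0, M 0 1], ?_⟩
    ext i j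
    fin_cases i <;> fin_cases j <;> simp [vecMulVec_apply, ha]
    field_simp
    linear_combination hM

/-- The trace of a product whose first factor is an outer product is a matrix element of the
product of the remaining factors. -/
theorem Matrix.trace_vecMulVec_mul_mul_mul {n R : Type*} [Fintype n] [CommRing R]
    (v w : n → R) (B C D : Matrix n n R) :
    (vecMulVec v w * B * C * D).trace = (w ᵥ* B) ⬝ᵥ (C *ᵥ (D *ᵥ v)) := by
  rw [vecMulVec_mul, vecMulVec_mul, vecMulVec_mul, trace_vecMulVec, dotProduct_comm,
    dotProduct_mulVec, dotProduct_mulVec]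

/-- The first matrix of a square-network solution of dimension 2 is invertible. -/
theorem isUnit_det_of_square_network_solution
    (A B C D : Fin 2 → Matrix (Fin 2) (Fin 2) ℂ)
    (h : ∀ i j k l : Fin 2,
      (A i * B j * C k * D l).trace =
        (if i = k then 1 else 0) * (if j = l then 1 else 0)) :
    IsUnit (A 0).det := by
  rw [isUnit_iff_ne_zero]
  intro hA
  obtain ⟨v, w, hvw⟩ := exists_eq_vecMulVec_of_det_eq_zero _ hA
  let Q : Matrix (Fin 2) (Fin 2) ℂ := of fun j => w ᵥ* B j
  let R : Matrix (Fin 2) (Fin 2) ℂ := (of fun l => D l *ᵥ v)ᵀ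
  have key (j k l : Fin 2) :
      (Q * (C k * R)) j l = (if 0 = k then 1 else 0) * (if j = l then 1 else 0) := by
    rw [← h 0 j k l, hvw, trace_vecMulVec_mul_mul_mul]
    rfl
  have h0 : Q * (C 0 * R) = 1 := by
    ext j l
    simp [key, one_apply]
  have h1 : Q * (C 1 * R) = 0 := by
    ext j l
    simp [key]
  have hQ : C 0 * R * Q = 1 := mul_eq_one_comm.mp h0
  have hR : R * (Q * C 0) = 1 := by
    rw [mul_eq_one_comm, Matrix.mul_assoc]
    exact h0
  have hC : C 1 = 0 := by
    calc C 1 = (C 0 * R * Q) * C 1 * (R * (Q * C 0)) := by simp [hQ, hR]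
      _ = C 0 * R * (Q * (C 1 * R)) * (Q * C 0) := by simp only [Matrix.mul_assoc]
      _ = 0 := by simp [h1]
  simpa [hC] using h 1 0 1 0

/-- Normal-form reduction: if a square-network solution of dimension 2 exists,
then one exists with `A 0 = 1`, `B 0 = 1` and `D 0 = 1`. -/
theorem square_network_solution_normal_form
    (A B C D : Fin 2 → Matrix (Fin 2) (Fin 2) ℂ)
    (h : ∀ i j k l : Fin 2,
      (A i * B j * C k * D l).trace =
        (if i = k then 1 else 0) * (if j = l then 1 else 0)) :
    ∃ A' B' C' D' : Fin 2 → Matrix (Fin 2) (Fin 2) ℂ,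
      A' 0 = 1 ∧ B' 0 = 1 ∧ D' 0 = 1 ∧
      ∀ i j k l : Fin 2,
        (A' i * B' j * C' k * D' l).trace =
          (if i = k then 1 else 0) * (if j = l then 1 else 0) := by
  have hA := isUnit_det_of_square_network_solution A B C D h
  have hB := isUnit_det_of_square_network_solution B C D A fun j k l i => by
    rw [trace_mul_comm, ← Matrix.mul_assoc, ← Matrix.mul_assoc, h, mul_comm]
    simp only [eq_comm]
  have hD := isUnit_det_of_square_network_solution D A B C fun l i j k => by
    rw [Matrix.mul_assoc, Matrix.mul_assoc, trace_mul_comm, ← Matrix.mul_assoc, h, mul_comm]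
    simp only [eq_comm]
  refine ⟨fun i => A i * (A 0)⁻¹, fun j => A 0 * B j * (B 0)⁻¹ * (A 0)⁻¹,
    fun k => A 0 * B 0 * C k * D 0, fun l => (D 0)⁻¹ * D l, mul_nonsing_inv _ hA, ?_,
    nonsing_inv_mul _ hD, fun i j k l => ?_⟩
  · simp only [mul_nonsing_inv_cancel_right _ _ hB, mul_nonsing_inv _ hA]
  · rw [← h i j k l]
    simp only [Matrix.mul_assoc, nonsing_inv_mul_cancel_left _ _ hA,
      nonsing_inv_mul_cancel_left _ _ hB, mul_nonsing_inv_cancel_left _ _ hD]
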